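/- Let u : ℝⁿ → ℝ be smooth and k-polyharmonic (Δᵏu = 0) on all of ℝⁿ for some k ≥ 2. Suppose there exists a constant C > 0 such that for all r > 0, ∫_{B_r} |Δ^{k−1}u|² ≤ (C/r^{4(k−1)}) ∫_{B_{2^{k−1}r}} u², and suppose sup_{B_r} |u| = o(r^{2(k−1)}) as r → ∞. Then Δ^{k−1}u ≡ 0, i.e. u is (k−1)-polyharmonic. -/

import Mathlib

open MeasureTheory Metric Filter
open scoped Topology RealInnerProductSpace

/-- The Euclidean Laplacian of `f : ℝⁿ → ℝ`. -/
noncomputable def lap {n : ℕ} (f : EuclideanSpace ℝ (Fin n) → ℝ)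
    (x : EuclideanSpace ℝ (Fin n)) : ℝ :=
  ∑ i : Fin n,
    fderiv ℝ (fun y => fderiv ℝ f y (EuclideanSpace.single i 1)) x (EuclideanSpace.single i 1)

/-- The quadratic cutoff `y ↦ (1 - ‖y‖²)₊`. -/
noncomputable def quadCutoff {n : ℕ} (y : EuclideanSpace ℝ (Fin n)) : ℝ :=
  max 0 (1 - ‖y‖ ^ 2)

lemma quadCutoff_nonneg {n : ℕ} (y : EuclideanSpace ℝ (Fin n)) : 0 ≤ quadCutoff y :=
  le_max_left _ _

lemma quadCutoff_le_one {n : ℕ} (y : EuclideanSpace ℝ (Fin n)) : quadCutoff y ≤ 1 :=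
  max_le zero_le_one (by nlinarith [sq_nonneg ‖y‖])

lemma quadCutoff_eq_zero {n : ℕ} {y : EuclideanSpace ℝ (Fin n)} (hy : 1 ≤ ‖y‖) :
    quadCutoff y = 0 :=
  max_eq_left (by nlinarith)

lemma continuous_quadCutoff {n : ℕ} :
    Continuous (quadCutoff : EuclideanSpace ℝ (Fin n) → ℝ) := by
  unfold quadCutoff
  fun_prop

lemma hasCompactSupport_quadCutoff {n : ℕ} :
    HasCompactSupport (quadCutoff : EuclideanSpace ℝ (Fin n) → ℝ) :=
  HasCompactSupport.intro (isCompact_closedBall 0 1) fun y hy ↦ quadCutoff_eq_zero (by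
    rw [mem_closedBall_zero_iff, not_le] at hy
    exact hy.le)

lemma integral_quadCutoff_pos {n : ℕ} :
    0 < ∫ y : EuclideanSpace ℝ (Fin n), quadCutoff y :=
  continuous_quadCutoff.integral_pos_of_hasCompactSupport_nonneg_nonzero
    hasCompactSupport_quadCutoff quadCutoff_nonneg (x := 0) (by simp [quadCutoff])

lemma hasDerivAt_max_zero_sq (s : ℝ) :
    HasDerivAt (fun t : ℝ ↦ max 0 t ^ 2) (2 * max 0 s) s := by
  rw [hasDerivAt_iff_isLittleO]
  have h : (fun t : ℝ ↦ (t - s) ^ 2) =o[𝓝 s] fun t ↦ t - s := by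
    simpa using Asymptotics.isLittleO_pow_sub_sub s (m := 2) (by norm_num)
  refine Asymptotics.IsBigO.trans_isLittleO (Asymptotics.IsBigO.of_bound 1 ?_) h
  refine Eventually.of_forall fun t ↦ ?_
  rw [Real.norm_eq_abs, Real.norm_eq_abs, abs_of_nonneg (sq_nonneg (t - s)), smul_eq_mul, abs_le]
  rcases le_total 0 t with ht | ht <;> rcases le_total 0 s with hs | hs <;>
    simp only [max_eq_left, max_eq_right, ht, hs] <;> constructor <;> nlinarith

lemma hasFDerivAt_quadCutoff_sq {n : ℕ} (y : EuclideanSpace ℝ (Fin n)) :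
    HasFDerivAt (fun z : EuclideanSpace ℝ (Fin n) ↦ quadCutoff z ^ 2)
      ((2 * quadCutoff y) • -(2 • innerSL ℝ y : EuclideanSpace ℝ (Fin n) →L[ℝ] ℝ)) y := by
  have h := (hasDerivAt_max_zero_sq (1 - ‖y‖ ^ 2)).comp_hasFDerivAt y
    ((hasStrictFDerivAt_norm_sq y).hasFDerivAt.const_sub 1)
  exact h

lemma fderiv_quadCutoff_sq_single {n : ℕ} (y : EuclideanSpace ℝ (Fin n)) (i : Fin n) :
    fderiv ℝ (fun z : EuclideanSpace ℝ (Fin n) ↦ quadCutoff z ^ 2) y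
      (EuclideanSpace.single i 1) = -4 * (y i * quadCutoff y) := by
  rw [(hasFDerivAt_quadCutoff_sq y).fderiv]
  simp [EuclideanSpace.inner_single_right]
  ring

lemma clm_apply_eq_sum_single {n : ℕ} (L : EuclideanSpace ℝ (Fin n) →L[ℝ] ℝ)
    (y : EuclideanSpace ℝ (Fin n)) :
    L y = ∑ i, y i * L (EuclideanSpace.single i 1) := by
  conv_lhs => rw [← (EuclideanSpace.basisFun (Fin n) ℝ).sum_repr y]
  simp

lemma ContDiff.fderiv_apply_const {n : ℕ} {f : EuclideanSpace ℝ (Fin n) → ℝ}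
    (hf : ContDiff ℝ (⊤ : ℕ∞) f) (w : EuclideanSpace ℝ (Fin n)) :
    ContDiff ℝ (⊤ : ℕ∞) fun y ↦ fderiv ℝ f y w :=
  (hf.fderiv_right (m := (⊤ : ℕ∞)) (by simp)).clm_apply contDiff_const

lemma ContDiff.lap {n : ℕ} {f : EuclideanSpace ℝ (Fin n) → ℝ}
    (hf : ContDiff ℝ (⊤ : ℕ∞) f) : ContDiff ℝ (⊤ : ℕ∞) (lap f) := by
  unfold _root_.lap
  exact ContDiff.sum fun i _ ↦ (hf.fderiv_apply_const _).fderiv_apply_const _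

lemma ContDiff.lap_iterate {n : ℕ} {f : EuclideanSpace ℝ (Fin n) → ℝ}
    (hf : ContDiff ℝ (⊤ : ℕ∞) f) (j : ℕ) : ContDiff ℝ (⊤ : ℕ∞) (_root_.lap^[j] f) := by
  induction j with
  | zero => exact hf
  | succ j ih =>
    rw [Function.iterate_succ_apply']
    exact ih.lap

lemma hasDerivAt_comp_ray {n : ℕ} {v : EuclideanSpace ℝ (Fin n) → ℝ}
    (hv : Differentiable ℝ v) (x y : EuclideanSpace ℝ (Fin n)) (R : ℝ) :
    HasDerivAt (fun r : ℝ ↦ v (x + r • y)) (fderiv ℝ v (x + R • y) y) R := by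
  have h : HasDerivAt (fun r : ℝ ↦ x + r • y) y R := by
    simpa using ((hasDerivAt_id R).smul_const y).const_add x
  exact (hv _).hasFDerivAt.comp_hasDerivAt R h

lemma fderiv_comp_dilation {n : ℕ} {g : EuclideanSpace ℝ (Fin n) → ℝ}
    (hg : Differentiable ℝ g) (x y w : EuclideanSpace ℝ (Fin n)) (R : ℝ) :
    fderiv ℝ (fun z ↦ g (x + R • z)) y w = R * fderiv ℝ g (x + R • y) w := by
  have h : HasFDerivAt (fun z : EuclideanSpace ℝ (Fin n) ↦ x + R • z)
      (R • ContinuousLinearMap.id ℝ (EuclideanSpace ℝ (Fin n))) y :=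
    ((hasFDerivAt_id y).const_smul R).const_add x
  have h' := (hg (x + R • y)).hasFDerivAt.comp y h
  rw [show (fun z ↦ g (x + R • z)) = g ∘ fun z ↦ x + R • z from rfl, h'.fderiv]
  simp

/-- Integrating the radial derivative of `v` against the cutoff produces the Laplacian. -/
lemma integral_radial_fderiv_mul_quadCutoff {n : ℕ} {v : EuclideanSpace ℝ (Fin n) → ℝ}
    (hv : ContDiff ℝ (⊤ : ℕ∞) v) (x : EuclideanSpace ℝ (Fin n)) (R : ℝ) :
    ∫ y, fderiv ℝ v (x + R • y) y * quadCutoff y =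
      R / 4 * ∫ y, lap v (x + R • y) * quadCutoff y ^ 2 := by
  have hD (i : Fin n) : ContDiff ℝ (⊤ : ℕ∞) fun z ↦ fderiv ℝ v z (EuclideanSpace.single i 1) :=
    hv.fderiv_apply_const _
  have hDD (i : Fin n) := (hD i).fderiv_apply_const (EuclideanSpace.single i 1)
  have hφ := continuous_quadCutoff (n := n)
  have hcs : HasCompactSupport fun y : EuclideanSpace ℝ (Fin n) ↦ quadCutoff y ^ 2 := by
    simp_rw [sq]
    exact hasCompactSupport_quadCutoff.mul_left
  have hline : Continuous fun y : EuclideanSpace ℝ (Fin n) ↦ x + R • y := by fun_prop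
  have hi1 (i : Fin n) : Integrable fun y : EuclideanSpace ℝ (Fin n) ↦
      fderiv ℝ v (x + R • y) (EuclideanSpace.single i 1) * (y i * quadCutoff y) :=
    Continuous.integrable_of_hasCompactSupport
      (((hD i).continuous.comp hline).mul (by fun_prop))
      (hasCompactSupport_quadCutoff.mul_left.mul_left)
  have hi2 (i : Fin n) : Integrable fun y : EuclideanSpace ℝ (Fin n) ↦
      fderiv ℝ (fun z ↦ fderiv ℝ v z (EuclideanSpace.single i 1)) (x + R • y)
        (EuclideanSpace.single i 1) * quadCutoff y ^ 2 :=
    Continuous.integrable_of_hasCompactSupport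
      (((hDD i).continuous.comp hline).mul (by fun_prop)) hcs.mul_left
  have hparts (i : Fin n) :
      ∫ y : EuclideanSpace ℝ (Fin n),
          fderiv ℝ v (x + R • y) (EuclideanSpace.single i 1) * (y i * quadCutoff y) =
        R / 4 * ∫ y : EuclideanSpace ℝ (Fin n),
          fderiv ℝ (fun z ↦ fderiv ℝ v z (EuclideanSpace.single i 1)) (x + R • y)
            (EuclideanSpace.single i 1) * quadCutoff y ^ 2 := by
    have hd : Differentiable ℝ fun z ↦ fderiv ℝ v z (EuclideanSpace.single i 1) :=
      (hD i).differentiable (by simp)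
    have h := integral_mul_fderiv_eq_neg_fderiv_mul_of_integrable (μ := volume)
      (f := fun y ↦ fderiv ℝ v (x + R • y) (EuclideanSpace.single i 1))
      (g := fun y ↦ quadCutoff y ^ 2) (v := EuclideanSpace.single i 1)
      (by
        simp only [fderiv_comp_dilation hd]
        simpa only [mul_assoc] using (hi2 i).const_mul R)
      (by
        simp only [fderiv_quadCutoff_sq_single]
        convert (hi1 i).const_mul (-4) using 2
        ring)
      (Continuous.integrable_of_hasCompactSupport
        (((hD i).continuous.comp hline).mul (by fun_prop)) hcs.mul_left)
      (fun y _ ↦ (hd _).comp y (by fun_prop))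
      (fun y _ ↦ (hasFDerivAt_quadCutoff_sq y).differentiableAt)
    simp only [fderiv_comp_dilation hd, fderiv_quadCutoff_sq_single, mul_left_comm _ (-4 : ℝ),
      mul_assoc, integral_const_mul] at h
    linarith
  calc
    ∫ y, fderiv ℝ v (x + R • y) y * quadCutoff y
      = ∫ y, ∑ i, fderiv ℝ v (x + R • y) (EuclideanSpace.single i 1) * (y i * quadCutoff y) := by
        congr 1 with y
        rw [clm_apply_eq_sum_single, Finset.sum_mul]
        exact Finset.sum_congr rfl fun i _ ↦ by ring
    _ = R / 4 * ∫ y, lap v (x + R • y) * quadCutoff y ^ 2 := by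
        simp only [lap, Finset.sum_mul]
        rw [integral_finsetSum _ fun i _ ↦ hi1 i, integral_finsetSum _ fun i _ ↦ hi2 i,
          Finset.mul_sum]
        exact Finset.sum_congr rfl fun i _ ↦ hparts i

lemma hasDerivAt_integral_mul_quadCutoff {n : ℕ} {v : EuclideanSpace ℝ (Fin n) → ℝ}
    (hv : ContDiff ℝ (⊤ : ℕ∞) v) (x : EuclideanSpace ℝ (Fin n)) (R : ℝ) :
    HasDerivAt (fun r : ℝ ↦ ∫ y, v (x + r • y) * quadCutoff y)
      (∫ y, fderiv ℝ v (x + R • y) y * quadCutoff y) R := by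
  have hφ := continuous_quadCutoff (n := n)
  have hD : Continuous (fderiv ℝ v) := hv.continuous_fderiv (by simp)
  have hvc := hv.continuous
  obtain ⟨B, hB⟩ := (isCompact_closedBall x (|R| + 1)).exists_bound_of_continuousOn hD.continuousOn
  refine (hasDerivAt_integral_of_dominated_loc_of_deriv_le
    (F := fun r y ↦ v (x + r • y) * quadCutoff y)
    (F' := fun r y ↦ fderiv ℝ v (x + r • y) y * quadCutoff y)
    (bound := fun y ↦ B * quadCutoff y) (ball_mem_nhds R one_pos)
    (Eventually.of_forall fun r ↦ ?_) ?_ ?_ ?_ ?_ ?_).2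
  · exact (Continuous.mul (by fun_prop) hφ).aestronglyMeasurable
  · exact Continuous.integrable_of_hasCompactSupport (Continuous.mul (by fun_prop) hφ)
      hasCompactSupport_quadCutoff.mul_left
  · exact (Continuous.mul (by fun_prop) hφ).aestronglyMeasurable
  · refine Eventually.of_forall fun y r hr ↦ ?_
    rw [norm_mul, Real.norm_of_nonneg (quadCutoff_nonneg y)]
    rcases le_total 1 ‖y‖ with hy | hy
    · simp [quadCutoff_eq_zero hy]
    · refine mul_le_mul_of_nonneg_right ?_ (quadCutoff_nonneg y)
      have hr' : |r| ≤ |R| + 1 := by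
        rw [mem_ball, Real.dist_eq] at hr
        linarith [abs_sub_abs_le_abs_sub r R]
      have hmem : x + r • y ∈ closedBall x (|R| + 1) := by
        rw [mem_closedBall, dist_eq_norm, add_sub_cancel_left, norm_smul, Real.norm_eq_abs]
        nlinarith [abs_nonneg r, norm_nonneg y]
      calc ‖fderiv ℝ v (x + r • y) y‖ ≤ ‖fderiv ℝ v (x + r • y)‖ * ‖y‖ :=
            ContinuousLinearMap.le_opNorm _ _
        _ ≤ ‖fderiv ℝ v (x + r • y)‖ := mul_le_of_le_one_right (norm_nonneg _) hy
        _ ≤ B := hB _ hmem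
  · exact (hφ.integrable_of_hasCompactSupport hasCompactSupport_quadCutoff).const_mul B
  · exact Eventually.of_forall fun y r _ ↦
      (hasDerivAt_comp_ray (hv.differentiable (by simp)) x y r).mul_const _

/-- Weighted mean value property of harmonic functions. -/
lemma integral_mul_quadCutoff_of_lap_eq_zero {n : ℕ} {v : EuclideanSpace ℝ (Fin n) → ℝ}
    (hv : ContDiff ℝ (⊤ : ℕ∞) v) (hlap : ∀ x, lap v x = 0)
    (x : EuclideanSpace ℝ (Fin n)) (R : ℝ) :
    ∫ y, v (x + R • y) * quadCutoff y = v x * ∫ y : EuclideanSpace ℝ (Fin n), quadCutoff y := by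
  have hderiv (r : ℝ) : HasDerivAt (fun r : ℝ ↦ ∫ y, v (x + r • y) * quadCutoff y) 0 r := by
    simpa [integral_radial_fderiv_mul_quadCutoff hv, hlap] using
      hasDerivAt_integral_mul_quadCutoff hv x r
  have h := is_const_of_deriv_eq_zero (fun r ↦ (hderiv r).differentiableAt)
    (fun r ↦ (hderiv r).deriv) R 0
  simpa [integral_const_mul] using h

/-- A local `L²` bound for harmonic functions. -/
lemma abs_mul_integral_quadCutoff_le {n : ℕ} {v : EuclideanSpace ℝ (Fin n) → ℝ}
    (hv : ContDiff ℝ (⊤ : ℕ∞) v) (hlap : ∀ x, lap v x = 0)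
    (x : EuclideanSpace ℝ (Fin n)) {R δ : ℝ} (hR : 0 < R) (hxR : ‖x‖ ≤ R) (hδ : 0 < δ) :
    |v x| * ∫ y : EuclideanSpace ℝ (Fin n), quadCutoff y ≤
      δ * volume.real (ball (0 : EuclideanSpace ℝ (Fin n)) 1) +
        δ⁻¹ * ((R ^ n)⁻¹ * ∫ z in ball (0 : EuclideanSpace ℝ (Fin n)) (2 * R), v z ^ 2) := by
  have hvc := hv.continuous
  have hφ := continuous_quadCutoff (n := n)
  have hint {f : EuclideanSpace ℝ (Fin n) → ℝ} (hf : Continuous f) (c : EuclideanSpace ℝ (Fin n))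
      (r : ℝ) : IntegrableOn f (ball c r) :=
    (hf.continuousOn.integrableOn_compact (isCompact_closedBall c r)).mono_set
      ball_subset_closedBall
  have hsupp : ∫ y, |v (x + R • y)| * quadCutoff y =
      ∫ y in ball (0 : EuclideanSpace ℝ (Fin n)) 1, |v (x + R • y)| * quadCutoff y := by
    refine (setIntegral_eq_integral_of_forall_compl_eq_zero fun y hy ↦ ?_).symm
    rw [mem_ball_zero_iff, not_lt] at hy
    rw [quadCutoff_eq_zero hy, mul_zero]
  have hpt (a b : ℝ) (ha : 0 ≤ a) (hb : b ≤ 1) : a * b ≤ δ + δ⁻¹ * a ^ 2 := by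
    have h1 : 0 ≤ δ⁻¹ * (a - δ) ^ 2 := by positivity
    have h2 : δ⁻¹ * (a - δ) ^ 2 = δ⁻¹ * a ^ 2 - 2 * a + δ := by
      field_simp
      ring
    nlinarith
  have hscale : ∫ y in ball (0 : EuclideanSpace ℝ (Fin n)) 1, v (x + R • y) ^ 2 ≤
      (R ^ n)⁻¹ * ∫ z in ball (0 : EuclideanSpace ℝ (Fin n)) (2 * R), v z ^ 2 := by
    calc ∫ y in ball (0 : EuclideanSpace ℝ (Fin n)) 1, v (x + R • y) ^ 2
      _ ≤ ∫ y in ball (-(R⁻¹ • x)) 2, v (x + R • y) ^ 2 := by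
          refine setIntegral_mono_set (hint (by fun_prop) _ _)
            (Eventually.of_forall fun y ↦ sq_nonneg _) (Eventually.of_forall ?_)
          refine ball_subset_ball' ?_
          have : ‖R⁻¹ • x‖ ≤ 1 := by
            rw [norm_smul, norm_inv, Real.norm_of_nonneg hR.le]
            exact inv_mul_le_one_of_le₀ hxR hR.le
          simp only [dist_eq_norm, sub_neg_eq_add, zero_add]
          linarith
      _ = ∫ y in ball (0 : EuclideanSpace ℝ (Fin n)) 2, v (R • y) ^ 2 := by
          rw [← integral_indicator measurableSet_ball, ← integral_indicator measurableSet_ball,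
            ← integral_add_left_eq_self _ (-(R⁻¹ • x))]
          congr 1 with y
          have hm : -(R⁻¹ • x) + y ∈ ball (-(R⁻¹ • x)) (2 : ℝ) ↔ y ∈ ball 0 (2 : ℝ) := by
            simp [dist_eq_norm]
          have he : x + R • (-(R⁻¹ • x) + y) = R • y := by
            rw [smul_add, smul_neg, smul_inv_smul₀ hR.ne', add_neg_cancel_left]
          by_cases hy : y ∈ ball (0 : EuclideanSpace ℝ (Fin n)) 2
          · rw [Set.indicator_of_mem (hm.2 hy), Set.indicator_of_mem hy, he]
          · rw [Set.indicator_of_notMem (mt hm.1 hy), Set.indicator_of_notMem hy]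
      _ = (R ^ n)⁻¹ * ∫ z in ball (0 : EuclideanSpace ℝ (Fin n)) (2 * R), v z ^ 2 := by
          rw [Measure.setIntegral_comp_smul_of_pos volume (fun z ↦ v z ^ 2) _ hR,
            _root_.smul_ball hR.ne', smul_zero, Real.norm_of_nonneg hR.le, mul_comm R,
            finrank_euclideanSpace_fin, smul_eq_mul]
  calc |v x| * ∫ y : EuclideanSpace ℝ (Fin n), quadCutoff y
    _ = |∫ y, v (x + R • y) * quadCutoff y| := by
        rw [integral_mul_quadCutoff_of_lap_eq_zero hv hlap, abs_mul,
          abs_of_pos integral_quadCutoff_pos]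
    _ ≤ ∫ y, |v (x + R • y)| * quadCutoff y := by
        refine abs_integral_le_integral_abs.trans_eq ?_
        simp only [abs_mul, abs_of_nonneg (quadCutoff_nonneg _)]
    _ ≤ ∫ y in ball (0 : EuclideanSpace ℝ (Fin n)) 1, (δ + δ⁻¹ * v (x + R • y) ^ 2) := by
        rw [hsupp]
        refine setIntegral_mono_on (hint (by fun_prop) _ _) (hint (by fun_prop) _ _)
          measurableSet_ball fun y _ ↦ ?_
        simpa using hpt _ _ (abs_nonneg (v (x + R • y))) (quadCutoff_le_one y)
    _ = δ * volume.real (ball (0 : EuclideanSpace ℝ (Fin n)) 1) +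
          δ⁻¹ * ∫ y in ball (0 : EuclideanSpace ℝ (Fin n)) 1, v (x + R • y) ^ 2 := by
        rw [integral_add (hint (by fun_prop) _ _) (hint (by fun_prop) _ _), integral_const_mul]
        simp [mul_comm]
    _ ≤ _ := by gcongr

lemma abs_le_iSup_ball {n : ℕ} {u : EuclideanSpace ℝ (Fin n) → ℝ} (hu : Continuous u) (r : ℝ)
    {y : EuclideanSpace ℝ (Fin n)} (hy : y ∈ ball 0 r) :
    |u y| ≤ ⨆ x ∈ ball (0 : EuclideanSpace ℝ (Fin n)) r, |u x| := by
  obtain ⟨B, hB⟩ := (isCompact_closedBall (0 : EuclideanSpace ℝ (Fin n))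
    r).exists_bound_of_continuousOn hu.continuousOn
  have hbdd : BddAbove (Set.range fun x ↦
      ⨆ _ : x ∈ ball (0 : EuclideanSpace ℝ (Fin n)) r, |u x|) := by
    refine ⟨max B 0, ?_⟩
    rintro _ ⟨x, rfl⟩
    exact Real.iSup_le (fun hx ↦ le_max_of_le_left (hB x (ball_subset_closedBall hx)))
      (le_max_right _ _)
  simpa [hy] using le_ciSup hbdd y

lemma setIntegral_ball_sq_le {n : ℕ} {u : EuclideanSpace ℝ (Fin n) → ℝ}
    {R ρ S : ℝ} (hR : 0 < R) (hS : ∀ y ∈ ball (0 : EuclideanSpace ℝ (Fin n)) (ρ * R), |u y| ≤ S) :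
    (R ^ n)⁻¹ * ∫ y in ball (0 : EuclideanSpace ℝ (Fin n)) (ρ * R), u y ^ 2 ≤
      S ^ 2 * volume.real (ball (0 : EuclideanSpace ℝ (Fin n)) ρ) := by
  have h := Measure.setIntegral_comp_smul_of_pos volume (fun z ↦ u z ^ 2)
    (ball (0 : EuclideanSpace ℝ (Fin n)) ρ) hR
  rw [_root_.smul_ball hR.ne', smul_zero, Real.norm_of_nonneg hR.le, mul_comm R,
    finrank_euclideanSpace_fin, smul_eq_mul] at h
  rw [← h]
  refine (le_abs_self _).trans ((Real.norm_eq_abs _).symm.trans_le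
    (norm_setIntegral_le_of_norm_le_const measure_ball_lt_top fun y hy ↦ ?_))
  rw [norm_pow, Real.norm_eq_abs]
  refine pow_le_pow_left₀ (abs_nonneg _) (hS _ ?_) 2
  rw [mem_ball_zero_iff] at hy ⊢
  rw [norm_smul, Real.norm_of_nonneg hR.le]
  nlinarith

/-- A k-polyharmonic function of growth o(r^{2(k-1)}) satisfying the L² estimate is
(k-1)-polyharmonic. -/
theorem polyharmonic_drop_order (n : ℕ) (k : ℕ) (hk : 2 ≤ k)
    (u : EuclideanSpace ℝ (Fin n) → ℝ) (hu : ContDiff ℝ (⊤ : ℕ∞) u)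
    (hpoly : ∀ x, lap^[k] u x = 0)
    (hest : ∃ C > 0, ∀ r : ℝ, 0 < r →
      ∫ x in ball (0 : EuclideanSpace ℝ (Fin n)) r, (lap^[k-1] u x) ^ 2 ≤
        C / r ^ (4 * (k - 1)) *
          ∫ x in ball (0 : EuclideanSpace ℝ (Fin n)) (2 ^ (k - 1) * r), (u x) ^ 2)
    (hgrowth :
      (fun r : ℝ => ⨆ x ∈ ball (0 : EuclideanSpace ℝ (Fin n)) r, |u x|) =o[atTop]
        (fun r : ℝ => r ^ (2 * (k - 1)))) :
    ∀ x, lap^[k-1] u x = 0 := by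
  have hvs := hu.lap_iterate (k - 1)
  have hlap (x) : lap (lap^[k - 1] u) x = 0 := by
    rw [← Function.iterate_succ_apply' lap, Nat.succ_eq_add_one, Nat.sub_add_cancel (by lia)]
    exact hpoly x
  generalize lap^[k - 1] u = v at *
  generalize k - 1 = m at *
  obtain ⟨C, hC, hest⟩ := hest
  intro x
  set M := ∫ y : EuclideanSpace ℝ (Fin n), quadCutoff y
  set V := volume.real (ball (0 : EuclideanSpace ℝ (Fin n)) 1)
  set W := volume.real (ball (0 : EuclideanSpace ℝ (Fin n)) (2 ^ m * 2))
  have key (ε : ℝ) (hε : 0 < ε) :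
      |v x| * M ≤ ε * V + ε⁻¹ * (C * ((ε * (2 ^ m) ^ (2 * m)) ^ 2 * W)) := by
    have hlim : Tendsto (fun R : ℝ ↦ 2 ^ m * (2 * R)) atTop atTop :=
      (tendsto_id.const_mul_atTop two_pos).const_mul_atTop (by positivity)
    obtain ⟨R, hsup, hR, hxR⟩ := ((hlim.eventually (hgrowth.def hε)).and
      ((eventually_gt_atTop 0).and (eventually_ge_atTop ‖x‖))).exists
    refine (abs_mul_integral_quadCutoff_le hvs hlap x hR hxR hε).trans ?_
    refine add_le_add_right (mul_le_mul_of_nonneg_left ?_ (by positivity)) _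
    set S := ε * (2 ^ m * (2 * R)) ^ (2 * m) with hSdef
    have hS : ∀ y ∈ ball (0 : EuclideanSpace ℝ (Fin n)) (2 ^ m * 2 * R), |u y| ≤ S := by
      intro y hy
      rw [mul_assoc] at hy
      refine (abs_le_iSup_ball hu.continuous _ hy).trans ((le_abs_self _).trans (hsup.trans_eq ?_))
      rw [Real.norm_of_nonneg (by positivity)]
    calc (R ^ n)⁻¹ * ∫ z in ball (0 : EuclideanSpace ℝ (Fin n)) (2 * R), v z ^ 2
      _ ≤ (R ^ n)⁻¹ * (C / (2 * R) ^ (4 * m) *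
            ∫ z in ball (0 : EuclideanSpace ℝ (Fin n)) (2 ^ m * (2 * R)), u z ^ 2) := by
          refine mul_le_mul_of_nonneg_left ?_ (by positivity)
          exact hest (2 * R) (by positivity)
      _ = C / (2 * R) ^ (4 * m) * ((R ^ n)⁻¹ *
            ∫ z in ball (0 : EuclideanSpace ℝ (Fin n)) (2 ^ m * 2 * R), u z ^ 2) := by
          rw [mul_left_comm, mul_assoc (2 ^ m)]
      _ ≤ C / (2 * R) ^ (4 * m) * (S ^ 2 * W) := by
          exact mul_le_mul_of_nonneg_left (setIntegral_ball_sq_le hR hS)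
            (by positivity)
      _ = C * ((ε * (2 ^ m) ^ (2 * m)) ^ 2 * W) := by
          have hS2 : S ^ 2 = (ε * (2 ^ m) ^ (2 * m)) ^ 2 * (2 * R) ^ (4 * m) := by
            rw [hSdef, mul_pow (2 ^ m : ℝ), ← mul_assoc, mul_pow _ ((2 * R) ^ (2 * m)),
              ← pow_mul (2 * R)]
            congr 2
            ring
          rw [hS2]
          field_simp
  have hle : |v x| * M ≤ 0 := by
    have hlim : Tendsto (fun ε : ℝ ↦ ε * (V + C * (((2 ^ m) ^ (2 * m)) ^ 2 * W)))
        (𝓝[>] 0) (𝓝 0) := by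
      refine Tendsto.mono_left ?_ nhdsWithin_le_nhds
      exact (continuous_mul_const _).tendsto' 0 0 (zero_mul _)
    refine ge_of_tendsto hlim (eventually_mem_nhdsWithin.mono fun ε hε ↦ (key ε hε).trans_eq ?_)
    have := (Set.mem_Ioi.1 hε).ne'
    field_simp
  have hM : 0 < M := integral_quadCutoff_pos
  exact abs_nonpos_iff.1 (nonpos_of_mul_nonpos_left hle hM)
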